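/- Weber's integral: for p with |arg p| < π/4, a, b > 0, and Re ν > -1, ∫₀^∞ e^{-p²t²} J_ν(at) J_ν(bt) t dt = (1/(2p²)) exp(-(a²+b²)/(4p²)) I_ν(ab/(2p²)), where J_ν is the Bessel function of the first kind and I_ν the modified Bessel function of the first kind. -/

import Mathlib

open Real Complex MeasureTheory

/-- Bessel function of the first kind, `J_ν(x) = Σ (-1)^m/(m! Γ(m+ν+1)) (x/2)^{2m+ν}`. -/
noncomputable def besselJ (ν : ℂ) (x : ℂ) : ℂ :=
  ∑' m : ℕ, ((-1)^m / ((m.factorial : ℂ) * Complex.Gamma ((m : ℂ) + ν + 1))) *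
    (x/2) ^ (2*(m:ℂ) + ν)

/-- Modified Bessel function of the first kind, `I_ν(x) = i^{-ν} J_ν(ix)`. -/
noncomputable def besselI (ν : ℂ) (x : ℂ) : ℂ :=
  Complex.I ^ (-ν) * besselJ ν (Complex.I * x)

open Set Filter Topology

theorem norm_cpow_mul_exp_neg_mul {t : ℝ} (ht : 0 < t) (a r : ℂ) :
    ‖(t : ℂ) ^ a * cexp (-(r * t))‖ = t ^ a.re * rexp (-(r.re * t)) := by
  rw [norm_mul, norm_cpow_eq_rpow_re_of_pos ht, Complex.norm_exp]
  simp

theorem integrableOn_rpow_mul_exp_neg_mul {a r : ℝ} (ha : -1 < a) (hr : 0 < r) :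
    IntegrableOn (fun t : ℝ => t ^ a * rexp (-(r * t))) (Ioi 0) := by
  simpa using integrableOn_rpow_mul_exp_neg_mul_rpow ha one_pos hr

theorem aestronglyMeasurable_cpow_mul_exp_neg_mul (a r : ℂ) (μ : Measure ℝ) :
    AEStronglyMeasurable (fun t : ℝ => (t : ℂ) ^ a * cexp (-(r * t))) μ := by
  have : Measurable (fun t : ℝ => (t : ℂ) ^ a * cexp (-(r * t))) := by fun_prop
  exact this.aestronglyMeasurable

theorem integrableOn_cpow_mul_exp_neg_mul {a r : ℂ} (ha : -1 < a.re) (hr : 0 < r.re) :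
    IntegrableOn (fun t : ℝ => (t : ℂ) ^ a * cexp (-(r * t))) (Ioi 0) := by
  refine (integrableOn_rpow_mul_exp_neg_mul ha hr).mono'
    (aestronglyMeasurable_cpow_mul_exp_neg_mul a r _) ?_
  filter_upwards [ae_restrict_mem measurableSet_Ioi] with t ht
  exact (norm_cpow_mul_exp_neg_mul ht a r).le

theorem hasDerivAt_integral_cpow_mul_exp_neg_mul {a r : ℂ} (ha : -1 < a.re) (hr : 0 < r.re) :
    HasDerivAt (fun z : ℂ => ∫ t in Ioi (0 : ℝ), (t : ℂ) ^ a * cexp (-(z * t)))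
      (∫ t in Ioi (0 : ℝ), (t : ℂ) ^ a * (cexp (-(r * t)) * -t)) r := by
  have hs : {z : ℂ | r.re / 2 < z.re} ∈ 𝓝 r :=
    (isOpen_lt continuous_const Complex.continuous_re).mem_nhds (by simpa using by linarith)
  refine (hasDerivAt_integral_of_dominated_loc_of_deriv_le
    (F' := fun z t => (t : ℂ) ^ a * (cexp (-(z * t)) * -t))
    (bound := fun t : ℝ => t ^ (a.re + 1) * rexp (-(r.re / 2 * t))) hs
    (.of_forall fun z => aestronglyMeasurable_cpow_mul_exp_neg_mul a z _)
    (integrableOn_cpow_mul_exp_neg_mul ha hr) ?_ ?_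
    (integrableOn_rpow_mul_exp_neg_mul (by linarith) (by linarith)) ?_).2
  · have : Measurable (fun t : ℝ => (t : ℂ) ^ a * (cexp (-(r * t)) * -t)) := by fun_prop
    exact this.aestronglyMeasurable
  · filter_upwards [ae_restrict_mem measurableSet_Ioi] with t ht z hz
    have ht : 0 < t := ht
    rw [← mul_assoc, norm_mul, norm_cpow_mul_exp_neg_mul ht, norm_neg, Complex.norm_real,
      Real.norm_of_nonneg ht.le, mul_right_comm, Real.rpow_add_one ht.ne']
    have hz : r.re / 2 < z.re := hz
    gcongr
  · filter_upwards with t z hz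
    have h := ((hasDerivAt_id z).mul_const (t : ℂ)).neg.cexp.const_mul ((t : ℂ) ^ a)
    simpa using h

/-- The Gamma integral with complex rate. -/
theorem integral_cpow_mul_exp_neg_mul {a r : ℂ} (ha : -1 < a.re) (hr : 0 < r.re) :
    ∫ t in Ioi (0 : ℝ), (t : ℂ) ^ a * cexp (-(r * t)) =
      (1 / r) ^ (a + 1) * Complex.Gamma (a + 1) := by
  have hopen : IsOpen {z : ℂ | 0 < z.re} := isOpen_lt continuous_const Complex.continuous_re
  have hF : AnalyticOnNhd ℂ (fun z : ℂ => ∫ t in Ioi (0 : ℝ), (t : ℂ) ^ a * cexp (-(z * t)))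
      {z : ℂ | 0 < z.re} :=
    DifferentiableOn.analyticOnNhd (fun z hz =>
      (hasDerivAt_integral_cpow_mul_exp_neg_mul ha hz).differentiableAt.differentiableWithinAt)
      hopen
  have hG : AnalyticOnNhd ℂ (fun z : ℂ => (1 / z) ^ (a + 1) * Complex.Gamma (a + 1))
      {z : ℂ | 0 < z.re} := by
    refine DifferentiableOn.analyticOnNhd (fun z (hz : 0 < z.re) => ?_) hopen
    have hz0 : z ≠ 0 := by rintro rfl; simp at hz
    have h1 : DifferentiableAt ℂ (fun z : ℂ => 1 / z) z := by fun_prop (disch := assumption)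
    refine ((h1.cpow_const ?_).mul_const _).differentiableWithinAt
    left
    rw [one_div, Complex.inv_re]
    exact div_pos hz (Complex.normSq_pos.2 hz0)
  refine hF.eqOn_of_preconnected_of_frequently_eq hG
    (convex_halfSpace_re_gt 0).isPreconnected (z₀ := 1) (by simp) ?_ hr
  have htend : Tendsto (fun x : ℝ => (x : ℂ)) (𝓝[≠] 1) (𝓝[≠] 1) := by
    refine tendsto_nhdsWithin_iff.2 ⟨?_, ?_⟩
    · exact (Complex.continuous_ofReal.tendsto' 1 1 (by simp)).mono_left nhdsWithin_le_nhds
    · filter_upwards [self_mem_nhdsWithin] with x hx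
      simpa using hx
  refine htend.frequently (Eventually.frequently ?_)
  filter_upwards [nhdsWithin_le_nhds (lt_mem_nhds (zero_lt_one' ℝ))] with x hx
  have := Complex.integral_cpow_mul_exp_neg_mul_Ioi (a := a + 1) (r := x)
    (by simpa using by linarith) hx
  simpa using this

/-- The Taylor coefficients of the entire function `z ↦ z ^ (-ν / 2) I_ν(2 √z)`. -/
noncomputable def besselCoeff (ν : ℂ) (m : ℕ) : ℂ :=
  ((m.factorial : ℂ) * Complex.Gamma (m + ν + 1))⁻¹

/-- The entire function `z ↦ z ^ (-ν / 2) I_ν(2 √z)`. -/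
noncomputable def besselSeries (ν z : ℂ) : ℂ :=
  ∑' m : ℕ, besselCoeff ν m * z ^ m

theorem Gamma_nat_add_ne_zero {ν : ℂ} (hν : -1 < ν.re) (m : ℕ) :
    Complex.Gamma (m + ν + 1) ≠ 0 := by
  refine Complex.Gamma_ne_zero_of_re_pos ?_
  have : (0 : ℝ) ≤ m := m.cast_nonneg
  simp only [add_re, natCast_re, one_re]
  linarith

theorem Gamma_nat_succ_add {ν : ℂ} (hν : -1 < ν.re) (m : ℕ) :
    Complex.Gamma ((m + 1 : ℕ) + ν + 1) = (m + ν + 1) * Complex.Gamma (m + ν + 1) := by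
  have h : (m + ν + 1 : ℂ) ≠ 0 := by
    intro h
    have h2 := congrArg Complex.re h
    have : (0 : ℝ) ≤ m := m.cast_nonneg
    simp only [add_re, natCast_re, one_re, zero_re] at h2
    linarith
  rw [← Complex.Gamma_add_one _ h]
  push_cast
  ring_nf

theorem norm_inv_Gamma_le {ν : ℂ} (hν : -1 < ν.re) (m : ℕ) :
    ‖(Complex.Gamma ((m + 1 : ℕ) + ν + 1))⁻¹‖ ≤
      ‖(Complex.Gamma (ν + 2))⁻¹‖ / m.factorial := by
  induction m with
  | zero =>
    apply le_of_eq
    simp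
    ring_nf
  | succ m ih =>
    rw [Gamma_nat_succ_add hν, mul_inv, norm_mul, Nat.factorial_succ, Nat.cast_mul, mul_comm,
      mul_comm ((m + 1 : ℕ) : ℝ), ← div_div, norm_inv (_ + _), ← div_eq_mul_inv]
    have h : ((m + 1 : ℕ) : ℝ) ≤ ‖((m + 1 : ℕ) + ν + 1 : ℂ)‖ := by
      refine le_trans ?_ (Complex.re_le_norm _)
      simp only [add_re, natCast_re, one_re]
      linarith
    gcongr

theorem norm_inv_Gamma_le_inv_Gamma_re {ν : ℂ} (hν : -1 < ν.re) (m : ℕ) :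
    ‖(Complex.Gamma (m + ν + 1))⁻¹‖ ≤
      ‖(Complex.Gamma (ν + 1))⁻¹‖ * ‖Complex.Gamma (ν.re + 1)‖ *
        ‖(Complex.Gamma (m + ν.re + 1))⁻¹‖ := by
  have hre : -1 < ((ν.re : ℝ) : ℂ).re := by simpa
  induction m with
  | zero =>
    have := norm_ne_zero_iff.2 (by simpa using Gamma_nat_add_ne_zero hre 0 :
      Complex.Gamma ((ν.re : ℂ) + 1) ≠ 0)
    simp [this]
  | succ m ih =>
    rw [Gamma_nat_succ_add hν, Gamma_nat_succ_add hre, mul_inv, mul_inv, norm_mul, norm_mul,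
      mul_left_comm]
    refine mul_le_mul ?_ ih (norm_nonneg _) (norm_nonneg _)
    have h0 : (0 : ℝ) ≤ m := m.cast_nonneg
    have h1 : (m + (ν.re : ℂ) + 1 : ℂ) = ((m + ν.re + 1 : ℝ) : ℂ) := by push_cast; ring
    rw [norm_inv, norm_inv, h1, Complex.norm_real, Real.norm_of_nonneg (by linarith)]
    refine inv_anti₀ (by linarith) ((le_of_eq ?_).trans (Complex.re_le_norm _))
    simp

theorem norm_besselCoeff_succ_le {ν : ℂ} (hν : -1 < ν.re) (m : ℕ) :
    ‖besselCoeff ν (m + 1)‖ ≤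
      ‖(Complex.Gamma (ν + 2))⁻¹‖ / ((m + 1).factorial * m.factorial) := by
  rw [besselCoeff, mul_inv, norm_mul, norm_inv, Complex.norm_natCast, mul_comm,
    mul_comm ((m + 1).factorial : ℝ) (m.factorial : ℝ), ← div_div, div_eq_mul_inv _ ((m + 1).factorial : ℝ)]
  gcongr
  exact norm_inv_Gamma_le hν m

theorem norm_besselCoeff_mul_pow_succ_le {ν : ℂ} (hν : -1 < ν.re) (z : ℂ) (m : ℕ) :
    ‖besselCoeff ν (m + 1) * z ^ (m + 1)‖ ≤
      ‖(Complex.Gamma (ν + 2))⁻¹‖ * √‖z‖ * rexp √‖z‖ * (√‖z‖ ^ m / m.factorial) := by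
  have hz : ‖z‖ ^ (m + 1) = √‖z‖ ^ (m + 1) * (√‖z‖ * √‖z‖ ^ m) := by
    rw [← pow_succ', ← mul_pow, Real.mul_self_sqrt (norm_nonneg z)]
  calc _ ≤ ‖(Complex.Gamma (ν + 2))⁻¹‖ / ((m + 1).factorial * m.factorial) * ‖z‖ ^ (m + 1) := by
        rw [norm_mul, norm_pow]
        gcongr
        exact norm_besselCoeff_succ_le hν m
    _ = ‖(Complex.Gamma (ν + 2))⁻¹‖ * √‖z‖ * (√‖z‖ ^ (m + 1) / (m + 1).factorial) *
          (√‖z‖ ^ m / m.factorial) := by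
        rw [hz]
        field_simp
    _ ≤ _ := by
        gcongr
        exact Real.pow_div_factorial_le_exp _ (Real.sqrt_nonneg _) _

theorem hasSum_pow_div_factorial_exp (x : ℝ) :
    HasSum (fun m : ℕ => x ^ m / m.factorial) (rexp x) := by
  rw [Real.exp_eq_exp_ℝ]
  exact NormedSpace.expSeries_div_hasSum_exp x

theorem summable_norm_besselCoeff_mul_pow {ν : ℂ} (hν : -1 < ν.re) (z : ℂ) :
    Summable fun m => ‖besselCoeff ν m * z ^ m‖ :=
  (summable_nat_add_iff 1).1 <| .of_nonneg_of_le (fun _ => norm_nonneg _)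
    (norm_besselCoeff_mul_pow_succ_le hν z)
    ((hasSum_pow_div_factorial_exp _).summable.mul_left _)

theorem hasSum_besselSeries {ν : ℂ} (hν : -1 < ν.re) (z : ℂ) :
    HasSum (fun m => besselCoeff ν m * z ^ m) (besselSeries ν z) :=
  (summable_norm_besselCoeff_mul_pow hν z).of_norm.hasSum

theorem norm_besselSeries_le {ν : ℂ} (hν : -1 < ν.re) (z : ℂ) :
    ‖besselSeries ν z‖ ≤
      ‖besselCoeff ν 0‖ + ‖(Complex.Gamma (ν + 2))⁻¹‖ * √‖z‖ * rexp (2 * √‖z‖) := by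
  have hs := summable_norm_besselCoeff_mul_pow hν z
  refine (norm_tsum_le_tsum_norm hs).trans ?_
  rw [hs.tsum_eq_zero_add, pow_zero, mul_one]
  gcongr
  rw [two_mul, Real.exp_add, ← mul_assoc]
  exact hasSum_le (norm_besselCoeff_mul_pow_succ_le hν z)
    ((summable_nat_add_iff 1).2 hs).hasSum ((hasSum_pow_div_factorial_exp _).mul_left _)

theorem measurable_besselSeries {ν : ℂ} (hν : -1 < ν.re) : Measurable (besselSeries ν) := by
  refine measurable_of_tendsto_metrizable
    (f := fun n z => ∑ m ∈ Finset.range n, besselCoeff ν m * z ^ m) (fun n => by fun_prop) ?_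
  exact tendsto_pi_nhds.2 fun z => (hasSum_besselSeries hν z).tendsto_sum_nat

theorem besselSeries_zero (ν : ℂ) : besselSeries ν 0 = (Complex.Gamma (ν + 1))⁻¹ := by
  rw [besselSeries, tsum_eq_single 0 fun m hm => by simp [hm]]
  simp [besselCoeff]

/-- A Chu-Vandermonde identity. -/
theorem sum_choose_mul_descFactorial_div_Gamma {ν : ℂ} (hν : -1 < ν.re) (m n : ℕ) :
    ∑ k ∈ Finset.range (m + 1), (m.choose k : ℂ) * n.descFactorial k / Complex.Gamma (k + ν + 1) =
      Complex.Gamma ((m + n : ℕ) + ν + 1) /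
        (Complex.Gamma (m + ν + 1) * Complex.Gamma (n + ν + 1)) := by
  induction m generalizing n ν with
  | zero =>
    have := Gamma_nat_add_ne_zero hν n
    simp
    field_simp
  | succ m ih =>
    have hν' : -1 < (ν + 1).re := by simpa using by linarith
    have hshift : ∀ k : ℕ, Complex.Gamma ((k + 1 : ℕ) + ν + 1) = Complex.Gamma (k + (ν + 1) + 1) :=
      fun k => by push_cast; ring_nf
    have key : ∑ k ∈ Finset.range (m + 1 + 1),
        ((m + 1).choose k : ℂ) * n.descFactorial k / Complex.Gamma (k + ν + 1) =
        ∑ k ∈ Finset.range (m + 1),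
          (m.choose k : ℂ) * n.descFactorial k / Complex.Gamma (k + ν + 1) +
        n * ∑ k ∈ Finset.range (m + 1), (m.choose k : ℂ) * (n - 1).descFactorial k /
          Complex.Gamma (k + (ν + 1) + 1) := by
      have h1 : ∑ k ∈ Finset.range (m + 1),
          (m.choose k : ℂ) * n.descFactorial k / Complex.Gamma (k + ν + 1) =
          ∑ k ∈ Finset.range (m + 1 + 1),
          (m.choose k : ℂ) * n.descFactorial k / Complex.Gamma (k + ν + 1) := by
        rw [Finset.sum_range_succ _ (m + 1)]
        simp
      rw [h1, Finset.sum_range_succ', Finset.sum_range_succ' _ (m + 1), Finset.mul_sum,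
        add_right_comm (Finset.sum _ _), ← Finset.sum_add_distrib]
      congr 1
      · refine Finset.sum_congr rfl fun k _ => ?_
        have hd : (n.descFactorial (k + 1) : ℂ) = n * (n - 1).descFactorial k := by
          cases n with
          | zero => simp
          | succ n => rw [Nat.succ_descFactorial_succ]; push_cast; simp
        rw [hshift, Nat.choose_succ_succ, hd]
        push_cast
        ring
      · simp
    rw [key, ih hν, ih hν']
    cases n with
    | zero =>
      have := Gamma_nat_add_ne_zero hν m
      have := Gamma_nat_add_ne_zero hν (m + 1)
      simp
      push_cast at this
      field_simp
    | succ n =>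
      have hg := Gamma_nat_add_ne_zero hν m
      have hg1 := Gamma_nat_add_ne_zero hν (n + 1)
      have hm := Gamma_nat_succ_add hν m
      have hmn := Gamma_nat_succ_add hν (m + n + 1)
      have hne := Gamma_nat_add_ne_zero hν (m + 1)
      have hf : (m + ν + 1 : ℂ) ≠ 0 := fun h => hne (by rw [hm, h, zero_mul])
      simp only [Nat.add_sub_cancel, ← hshift]
      rw [show m + 1 + (n + 1) = m + n + 1 + 1 by ring, show m + (n + 1) = m + n + 1 by ring, hmn,
        hm]
      push_cast at *
      field_simp
      ring

/-- The product of two exponentials and a Bessel series, as a double power series. -/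
theorem hasSum_exp_mul_besselSeries {ν : ℂ} (hν : -1 < ν.re) (x y : ℂ) :
    HasSum (fun q : ℕ × ℕ => besselCoeff ν q.1 * besselCoeff ν q.2 *
      Complex.Gamma ((q.1 + q.2 : ℕ) + ν + 1) * (x ^ q.1 * y ^ q.2))
      (cexp (x + y) * besselSeries ν (x * y)) := by
  have hexp : ∀ z : ℂ, HasSum (fun n : ℕ => z ^ n / n.factorial) (cexp z) := fun z => by
    rw [Complex.exp_eq_exp_ℂ]
    exact NormedSpace.expSeries_div_hasSum_exp z
  have hexpn : ∀ z : ℂ, Summable fun n : ℕ => ‖z ^ n / n.factorial‖ := fun z => by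
    simpa using (hasSum_pow_div_factorial_exp ‖z‖).summable
  have hb := summable_norm_besselCoeff_mul_pow hν (x * y)
  have h2 := (hexp x).mul (hexp y) ((hexpn x).mul_norm (hexpn y)).of_norm
  have h3 := (hasSum_besselSeries hν (x * y)).mul h2
    (hb.mul_norm ((hexpn x).mul_norm (hexpn y))).of_norm
  let φ : ℕ × ℕ × ℕ → (ℕ × ℕ) × ℕ := fun q => ((q.1 + q.2.1, q.1 + q.2.2), q.1)
  have hφ : Function.Injective φ := by
    rintro ⟨k, i, j⟩ ⟨k', i', j'⟩ h
    simp only [φ, Prod.mk.injEq] at h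
    simp only [Prod.mk.injEq]
    lia
  let g : (ℕ × ℕ) × ℕ → ℂ := fun q =>
    (q.1.1.choose q.2 : ℂ) * q.1.2.descFactorial q.2 / Complex.Gamma (q.2 + ν + 1) *
      (x ^ q.1.1 * y ^ q.1.2 / (q.1.1.factorial * q.1.2.factorial))
  have hg : ∀ q ∉ range φ, g q = 0 := by
    rintro ⟨⟨m, n⟩, k⟩ hq
    by_cases hm : m < k
    · simp [g, Nat.choose_eq_zero_of_lt hm]
    by_cases hn : n < k
    · simp [g, Nat.descFactorial_eq_zero_iff_lt.2 hn]
    exact absurd ⟨(k, m - k, n - k), by simp only [φ, Prod.mk.injEq]; lia⟩ hq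
  have hgφ : g ∘ φ = fun q : ℕ × ℕ × ℕ => besselCoeff ν q.1 * (x * y) ^ q.1 *
      (x ^ q.2.1 / q.2.1.factorial * (y ^ q.2.2 / q.2.2.factorial)) := by
    ext ⟨k, i, j⟩
    have h1 : ((k + i).choose k : ℂ) * (k.factorial * i.factorial) = (k + i).factorial := by
      have := Nat.choose_mul_factorial_mul_factorial (Nat.le_add_right k i)
      rw [Nat.add_sub_cancel_left, mul_assoc] at this
      exact_mod_cast this
    have h2 : (j.factorial : ℂ) * (k + j).descFactorial k = (k + j).factorial := by
      have := Nat.factorial_mul_descFactorial (Nat.le_add_right k j)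
      rw [Nat.add_sub_cancel_left] at this
      exact_mod_cast this
    have f0 : ∀ n : ℕ, (n.factorial : ℂ) ≠ 0 := fun n => by exact_mod_cast n.factorial_ne_zero
    have hG := Gamma_nat_add_ne_zero hν k
    have fk := f0 k
    have fi := f0 i
    have fj := f0 j
    have fki := f0 (k + i)
    have fkj := f0 (k + j)
    simp only [g, φ, Function.comp_apply, besselCoeff]
    rw [eq_div_of_mul_eq (mul_ne_zero fk fi) h1, eq_div_of_mul_eq fj ((mul_comm _ _).trans h2)]
    field_simp
    ring
  have h4 : HasSum g (besselSeries ν (x * y) * (cexp x * cexp y)) :=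
    (hφ.hasSum_iff hg).1 (hgφ ▸ h3)
  rw [Complex.exp_add, mul_comm]
  refine h4.prod_fiberwise ?_
  rintro ⟨m, n⟩
  have hfin : HasSum (fun k => g ((m, n), k)) (∑ k ∈ Finset.range (m + 1), g ((m, n), k)) :=
    hasSum_sum_of_ne_finset_zero fun k hk => by
      have : m < k := by simpa using hk
      simp [g, Nat.choose_eq_zero_of_lt this]
  convert hfin using 1
  simp only [g]
  rw [← Finset.sum_mul, sum_choose_mul_descFactorial_div_Gamma hν]
  simp only [besselCoeff]
  field_simp

theorem norm_besselCoeff_le {ν : ℂ} (hν : -1 < ν.re) (m : ℕ) :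
    ‖besselCoeff ν m‖ ≤ ‖(Complex.Gamma (ν + 1))⁻¹‖ * ‖Complex.Gamma (ν.re + 1)‖ *
      ‖besselCoeff ν.re m‖ := by
  simp only [besselCoeff, mul_inv, norm_mul]
  rw [mul_left_comm]
  exact mul_le_mul_of_nonneg_left (norm_inv_Gamma_le_inv_Gamma_re hν m) (norm_nonneg _)

/-- The Laplace transform of `u ^ ν` times a product of two Bessel series. -/
theorem integral_cpow_mul_exp_mul_besselSeries_mul {ν s : ℂ} (hν : -1 < ν.re) (hs : 0 < s.re)
    (x y : ℂ) :
    ∫ u in Ioi (0 : ℝ), (u : ℂ) ^ ν * cexp (-(s * u)) *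
        (besselSeries ν (x * u) * besselSeries ν (y * u)) =
      (1 / s) ^ (ν + 1) * (cexp ((x + y) / s) * besselSeries ν (x * y / s ^ 2)) := by
  have hs0 : s ≠ 0 := by rintro rfl; simp at hs
  let K : ℕ × ℕ → ℂ := fun q => besselCoeff ν q.1 * besselCoeff ν q.2 * (x ^ q.1 * y ^ q.2)
  let F : ℕ × ℕ → ℝ → ℂ := fun q u =>
    K q * ((u : ℂ) ^ (ν + (q.1 + q.2 : ℕ)) * cexp (-(s * u)))
  have hre : ∀ n : ℕ, -1 < (ν + (n : ℂ)).re := fun n => by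
    have : (0 : ℝ) ≤ n := n.cast_nonneg
    simp only [add_re, natCast_re]
    linarith
  have hFint : ∀ q, Integrable (F q) (volume.restrict (Ioi 0)) := fun q =>
    (integrableOn_cpow_mul_exp_neg_mul (hre _) hs).const_mul _
  have hFnorm : ∀ q, ∫ u in Ioi (0 : ℝ), ‖F q u‖ =
      ‖K q‖ * ((1 / s.re) ^ (ν.re + (q.1 + q.2 : ℕ) + 1) *
        Real.Gamma (ν.re + (q.1 + q.2 : ℕ) + 1)) := fun q => by
    have h := hre (q.1 + q.2)
    simp only [add_re, natCast_re] at h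
    rw [← Real.integral_rpow_mul_exp_neg_mul_Ioi (by linarith) hs, ← integral_const_mul]
    refine setIntegral_congr_fun measurableSet_Ioi fun u hu => ?_
    simp only [F, norm_mul (K q), norm_cpow_mul_exp_neg_mul hu]
    simp
  have hρ : -1 < ((ν.re : ℝ) : ℂ).re := by simpa
  have hsum : Summable fun q => ∫ u in Ioi (0 : ℝ), ‖F q u‖ := by
    set D := ‖(Complex.Gamma (ν + 1))⁻¹‖ * ‖Complex.Gamma (ν.re + 1)‖
    have hS := (hasSum_exp_mul_besselSeries hρ ((‖x‖ / s.re : ℝ) : ℂ)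
      ((‖y‖ / s.re : ℝ) : ℂ)).summable.norm.mul_left (D * D * (1 / s.re) ^ (ν.re + 1))
    refine hS.of_nonneg_of_le (fun q => integral_nonneg fun u => norm_nonneg _) fun q => ?_
    have hG : ‖Complex.Gamma ((q.1 + q.2 : ℕ) + (ν.re : ℂ) + 1)‖ =
        Real.Gamma (ν.re + (q.1 + q.2 : ℕ) + 1) := by
      have h1 : ((q.1 + q.2 : ℕ) + (ν.re : ℂ) + 1) =
        ((ν.re + (q.1 + q.2 : ℕ) + 1 : ℝ) : ℂ) := by push_cast; ring
      have h := hre (q.1 + q.2)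
      simp only [add_re, natCast_re] at h
      rw [h1, Complex.Gamma_ofReal, Complex.norm_real, Real.norm_of_nonneg]
      exact (Real.Gamma_pos_of_pos (by linarith)).le
    have hpos := (norm_nonneg _).trans_eq hG
    rw [hFnorm]
    simp only [norm_mul, hG, K, norm_pow, Complex.norm_real, Real.norm_of_nonneg
      (div_nonneg (norm_nonneg _) hs.le)]
    rw [add_right_comm, Real.rpow_add_natCast (one_div_pos.2 hs).ne', one_div, pow_add,
      inv_pow, inv_pow]
    calc _ ≤ (D * ‖besselCoeff ν.re q.1‖) * (D * ‖besselCoeff ν.re q.2‖) *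
          (‖x‖ ^ q.1 * ‖y‖ ^ q.2) * (s.re⁻¹ ^ (ν.re + 1) *
          ((s.re ^ q.1)⁻¹ * (s.re ^ q.2)⁻¹) * Real.Gamma (ν.re + 1 + (q.1 + q.2 : ℕ))) := by
          rw [add_right_comm] at hpos
          gcongr
          · exact norm_besselCoeff_le hν _
          · exact norm_besselCoeff_le hν _
      _ = _ := by
          rw [add_right_comm ν.re]
          ring
  have hmain := hasSum_integral_of_summable_integral_norm hFint hsum
  have hFi : ∀ q, ∫ u in Ioi (0 : ℝ), F q u = (1 / s) ^ (ν + 1) *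
      (besselCoeff ν q.1 * besselCoeff ν q.2 *
        Complex.Gamma ((q.1 + q.2 : ℕ) + ν + 1) * ((x / s) ^ q.1 * (y / s) ^ q.2)) := fun q => by
    simp only [F, K]
    rw [integral_const_mul, integral_cpow_mul_exp_neg_mul (hre _) hs, add_right_comm,
      Complex.cpow_add _ _ (one_div_ne_zero hs0), Complex.cpow_natCast, pow_add, div_pow x,
      div_pow y, div_pow, div_pow, add_right_comm, add_comm ν]
    simp only [one_pow]
    ring_nf
  simp only [hFi] at hmain
  have h := hmain.unique ((hasSum_exp_mul_besselSeries hν (x / s) (y / s)).mul_left _)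
  rw [show x * y / s ^ 2 = x / s * (y / s) by field_simp, add_div, ← h]
  refine setIntegral_congr_fun measurableSet_Ioi fun u hu => ?_
  have hu0 : (u : ℂ) ≠ 0 := by exact_mod_cast (ne_of_gt hu : u ≠ 0)
  have hE := summable_norm_besselCoeff_mul_pow hν (x * u)
  have hE' := summable_norm_besselCoeff_mul_pow hν (y * u)
  simp only [besselSeries]
  rw [tsum_mul_tsum_of_summable_norm hE hE', ← tsum_mul_left]
  refine tsum_congr fun q => ?_
  simp only [F, K]
  rw [Complex.cpow_add _ _ hu0, Complex.cpow_natCast, pow_add, mul_pow, mul_pow]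
  ring

theorem integral_cpow_mul_exp_mul_besselSeries {ν s : ℂ} (hν : -1 < ν.re) (hs : 0 < s.re)
    (x : ℂ) :
    ∫ u in Ioi (0 : ℝ), (u : ℂ) ^ ν * cexp (-(s * u)) * besselSeries ν (x * u) =
      (1 / s) ^ (ν + 1) * cexp (x / s) := by
  have h := integral_cpow_mul_exp_mul_besselSeries_mul hν hs x 0
  have h0 : besselSeries ν 0 ≠ 0 := by
    rw [besselSeries_zero]
    exact inv_ne_zero (by simpa using Gamma_nat_add_ne_zero hν 0)
  simp only [zero_mul, mul_zero, zero_div, add_zero, ← mul_assoc] at h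
  rw [integral_mul_const] at h
  exact mul_right_cancel₀ h0 h

/-- Orthogonality: distinct scalings of a Bessel function have vanishing integral. -/
theorem integral_cpow_mul_besselSeries_mul_eq_zero {ν : ℂ} (hν : -1 < ν.re) {x y : ℝ}
    (hx : 0 < x) (hy : 0 < y) (hxy : x ≠ y)
    (hint : IntegrableOn (fun u : ℝ => (u : ℂ) ^ ν *
      (besselSeries ν (-x * u) * besselSeries ν (-y * u))) (Ioi 0)) :
    ∫ u in Ioi (0 : ℝ), (u : ℂ) ^ ν * (besselSeries ν (-x * u) * besselSeries ν (-y * u)) = 0 := by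
  have hE := measurable_besselSeries hν
  let F : ℝ → ℝ → ℂ := fun r u => (u : ℂ) ^ ν * cexp (-((1 / r : ℝ) * u)) *
    (besselSeries ν (-x * u) * besselSeries ν (-y * u))
  have hlim : Tendsto (fun r => ∫ u in Ioi (0 : ℝ), F r u) atTop (𝓝 (∫ u in Ioi (0 : ℝ),
      (u : ℂ) ^ ν * (besselSeries ν (-x * u) * besselSeries ν (-y * u)))) := by
    refine tendsto_integral_filter_of_dominated_convergence _ ?_ ?_ hint.norm ?_
    · refine .of_forall fun r => Measurable.aestronglyMeasurable ?_
      fun_prop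
    · filter_upwards [eventually_gt_atTop 0] with r hr
      filter_upwards [ae_restrict_mem measurableSet_Ioi] with u hu
      have hu : 0 < u := hu
      simp only [F, norm_mul, Complex.norm_exp]
      gcongr
      refine mul_le_of_le_one_right (norm_nonneg _) (Real.exp_le_one_iff.2 ?_)
      rw [← Complex.ofReal_mul, ← Complex.ofReal_neg, Complex.ofReal_re]
      have : 0 ≤ 1 / r * u := by positivity
      linarith
    · filter_upwards with u
      have h1 : Tendsto (fun r : ℝ => cexp (-((1 / r : ℝ) * u))) atTop (𝓝 1) := by
        have h2 : Continuous fun r : ℝ => cexp (-(r * u)) := by fun_prop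
        have h3 : Tendsto (fun r : ℝ => 1 / r) atTop (𝓝 0) := by
          simpa using tendsto_inv_atTop_zero (𝕜 := ℝ)
        exact (h2.tendsto' 0 1 (by simp)).comp h3
      simpa [F] using (h1.const_mul ((u : ℂ) ^ ν)).mul_const
        (besselSeries ν (-x * u) * besselSeries ν (-y * u))
  refine tendsto_nhds_unique hlim (tendsto_zero_iff_norm_tendsto_zero.2 ?_)
  set A := ‖besselCoeff ν 0‖
  set B := ‖(Complex.Gamma (ν + 2))⁻¹‖
  have hd : 0 < x + y - 2 * √(x * y) := by
    have h1 : √x ≠ √y := fun h => hxy (by rwa [Real.sqrt_inj hx.le hy.le] at h)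
    have h2 := sq_pos_of_ne_zero (sub_ne_zero.2 h1)
    rw [sub_sq, Real.sq_sqrt hx.le, Real.sq_sqrt hy.le] at h2
    rw [Real.sqrt_mul hx.le]
    linarith
  have hbound : Tendsto (fun r : ℝ => A * (r ^ (ν.re + 1) * rexp (-(x + y) * r)) +
      B * √(x * y) * (r ^ (ν.re + 2) * rexp (-(x + y - 2 * √(x * y)) * r))) atTop (𝓝 0) := by
    simpa using ((tendsto_rpow_mul_exp_neg_mul_atTop_nhds_zero (ν.re + 1) (x + y)
      (by linarith)).const_mul A).add ((tendsto_rpow_mul_exp_neg_mul_atTop_nhds_zero (ν.re + 2) _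
      hd).const_mul (B * √(x * y)))
  refine squeeze_zero' (.of_forall fun r => norm_nonneg _) ?_ hbound
  filter_upwards [eventually_gt_atTop 0] with r hr
  have hr' : 0 < (((1 / r : ℝ) : ℝ) : ℂ).re := by
    rw [Complex.ofReal_re]
    positivity
  simp only [F]
  rw [integral_cpow_mul_exp_mul_besselSeries_mul hν hr']
  have e1 : (1 / ((1 / r : ℝ) : ℂ)) = (r : ℂ) := by push_cast; simp
  have e2 : ((-x + -y) / ((1 / r : ℝ) : ℂ)) = ((-(x + y) * r : ℝ) : ℂ) := by
    rw [div_eq_mul_one_div, e1]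
    push_cast
    ring
  have e3 : (-x * -y / ((1 / r : ℝ) : ℂ) ^ 2) = ((x * y * r ^ 2 : ℝ) : ℂ) := by
    push_cast; simp
  have e4 : √‖((x * y * r ^ 2 : ℝ) : ℂ)‖ = √(x * y) * r := by
    rw [Complex.norm_real, Real.norm_of_nonneg (by positivity), Real.sqrt_mul (by positivity),
      Real.sqrt_sq hr.le]
  have hb := norm_besselSeries_le hν ((x * y * r ^ 2 : ℝ) : ℂ)
  rw [e4] at hb
  rw [e1, e2, e3, norm_mul, norm_mul, norm_cpow_eq_rpow_re_of_pos hr, ← Complex.ofReal_exp,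
    Complex.norm_real, Real.norm_of_nonneg (Real.exp_pos _).le, add_re, one_re]
  calc _ ≤ r ^ (ν.re + 1) * (rexp (-(x + y) * r) *
        (A + B * (√(x * y) * r) * rexp (2 * (√(x * y) * r)))) := by gcongr
    _ = _ := by
      rw [show ν.re + 2 = ν.re + 1 + 1 by ring, Real.rpow_add_one hr.ne' (ν.re + 1),
        show -(x + y - 2 * √(x * y)) * r = -(x + y) * r + 2 * (√(x * y) * r) by ring,
        Real.exp_add]
      ring

/-- After substituting `u = t ^ 2`, this says that `t * J_ν(c t) ^ 2` is not integrable. -/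
theorem not_integrableOn_cpow_mul_besselSeries_sq {ν : ℂ} (hν : -1 < ν.re) {x : ℝ} (hx : 0 < x) :
    ¬ IntegrableOn (fun u : ℝ => (u : ℂ) ^ ν *
      (besselSeries ν (-x * u) * besselSeries ν (-x * u))) (Ioi 0) := by
  intro hint
  have hE := measurable_besselSeries hν
  let w : ℝ → ℝ → ℝ := fun b u => u ^ ν.re * ‖besselSeries ν (-b * u)‖ ^ 2
  have hw_scale : ∀ {b : ℝ}, 0 < b → ∀ u ∈ Ioi (0 : ℝ), w b u = b ^ (-ν.re) * w 1 (b * u) := by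
    intro b hb u hu
    have hu : 0 < u := hu
    simp only [w]
    rw [Real.mul_rpow hb.le hu.le, Real.rpow_neg hb.le]
    have := (Real.rpow_pos_of_pos hb ν.re).ne'
    push_cast
    field_simp
  have hwx : IntegrableOn (w x) (Ioi 0) := by
    refine (integrableOn_congr_fun (fun u hu => ?_) measurableSet_Ioi).1 hint.norm
    have hu : 0 < u := hu
    simp only [w, norm_mul, norm_cpow_eq_rpow_re_of_pos hu, sq]
  have hw1 : IntegrableOn (w 1) (Ioi 0) := by
    have h := (integrableOn_congr_fun (hw_scale hx) measurableSet_Ioi).1 hwx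
    have h2 := h.const_mul (x ^ (-ν.re))⁻¹
    have h3 := (Real.rpow_pos_of_pos hx (-ν.re)).ne'
    simp only [inv_mul_cancel_left₀ h3] at h2
    simpa using (integrableOn_Ioi_comp_mul_left_iff (w 1) 0 hx).1 h2
  have hw : ∀ {b : ℝ}, 0 < b → IntegrableOn (w b) (Ioi 0) := fun {b} hb => by
    refine (integrableOn_congr_fun (hw_scale hb) measurableSet_Ioi).2 (Integrable.const_mul ?_ _)
    exact (integrableOn_Ioi_comp_mul_left_iff (w 1) 0 hb).2 (by simpa using hw1)
  set N := ∫ u in Ioi (0 : ℝ), w 1 u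
  have hwN : ∀ {b : ℝ}, 0 < b → ∫ u in Ioi (0 : ℝ), w b u = b ^ (-(ν.re + 1)) * N := by
    intro b hb
    rw [setIntegral_congr_fun measurableSet_Ioi (hw_scale hb), integral_const_mul,
      integral_comp_mul_left_Ioi (w 1) 0 hb, mul_zero, smul_eq_mul, neg_add, Real.rpow_add hb,
      Real.rpow_neg_one, mul_assoc]
  let P : ℝ → ℝ → ℂ := fun b u =>
    (u : ℂ) ^ ν * (besselSeries ν (-x * u) * besselSeries ν (-b * u))
  have hPbound : ∀ {b l : ℝ}, 0 < b → 0 < l → ∀ u ∈ Ioi (0 : ℝ),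
      ‖P b u‖ ≤ (l * w x u + l⁻¹ * w b u) / 2 := by
    intro b l hb hl u hu
    have hu : 0 < u := hu
    simp only [P, w, norm_mul, norm_cpow_eq_rpow_re_of_pos hu]
    set A := ‖besselSeries ν (-x * u)‖
    set B := ‖besselSeries ν (-b * u)‖
    have h : A * B ≤ (l * A ^ 2 + l⁻¹ * B ^ 2) / 2 := by
      have : (l * A ^ 2 + l⁻¹ * B ^ 2) / 2 - A * B = l⁻¹ * (l * A - B) ^ 2 / 2 := by
        field_simp
        ring
      have : 0 ≤ l⁻¹ * (l * A - B) ^ 2 / 2 := by positivity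
      linarith
    calc _ ≤ u ^ ν.re * ((l * A ^ 2 + l⁻¹ * B ^ 2) / 2) := by gcongr
      _ = _ := by ring
  have hPmeas : Measurable (Function.uncurry P) := by
    simp only [P, Function.uncurry_def]
    fun_prop
  have hPint : ∀ {b : ℝ}, 0 < b → IntegrableOn (P b) (Ioi 0) := by
    intro b hb
    refine Integrable.mono' (((hw hx).const_mul 1).add ((hw hb).const_mul 1⁻¹) |>.div_const 2)
      (hPmeas.comp measurable_prodMk_left).aestronglyMeasurable ?_
    filter_upwards [ae_restrict_mem measurableSet_Ioi] with u hu
    exact hPbound hb one_pos u hu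
  have hPnorm : ∀ {b : ℝ}, 0 < b → ∫ u in Ioi (0 : ℝ), ‖P b u‖ ≤
      (x ^ (-(ν.re + 1)) * N + N) / 2 * b ^ (-((ν.re + 1) / 2)) := by
    intro b hb
    set l := b ^ (-((ν.re + 1) / 2))
    have hl : 0 < l := Real.rpow_pos_of_pos hb _
    calc _ ≤ ∫ u in Ioi (0 : ℝ), (l * w x u + l⁻¹ * w b u) / 2 :=
          setIntegral_mono_on (hPint hb).norm
            (((hw hx).const_mul l).add ((hw hb).const_mul l⁻¹) |>.div_const 2)
            measurableSet_Ioi (hPbound hb hl)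
      _ = (l * (x ^ (-(ν.re + 1)) * N) + l⁻¹ * (b ^ (-(ν.re + 1)) * N)) / 2 := by
          rw [integral_div, integral_add ((hw hx).const_mul l) ((hw hb).const_mul l⁻¹),
            integral_const_mul, integral_const_mul, hwN hx, hwN hb]
      _ = _ := by
          have h : b ^ (-(ν.re + 1)) = l * l := by
            rw [← Real.rpow_add hb]
            ring_nf
          rw [h]
          field_simp
  let F : ℝ → ℝ → ℂ := fun b u => ((b : ℂ) ^ ν * cexp (-(1 * b))) * P b u
  have hFint : Integrable (Function.uncurry F)
      ((volume.restrict (Ioi 0)).prod (volume.restrict (Ioi 0))) := by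
    have hFmeas : Measurable (Function.uncurry F) := by
      simp only [F, P, Function.uncurry_def]
      fun_prop
    refine (integrable_prod_iff hFmeas.aestronglyMeasurable).2 ⟨?_, ?_⟩
    · filter_upwards [ae_restrict_mem measurableSet_Ioi] with b hb
      exact (hPint hb).const_mul ((b : ℂ) ^ ν * cexp (-(1 * b)))
    · refine Integrable.mono' ((integrableOn_rpow_mul_exp_neg_mul
        (a := (ν.re - 1) / 2) (by linarith) one_pos).const_mul
        ((x ^ (-(ν.re + 1)) * N + N) / 2))
        hFmeas.aestronglyMeasurable.norm.integral_prod_right' ?_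
      filter_upwards [ae_restrict_mem measurableSet_Ioi] with b hb
      have hb : 0 < b := hb
      rw [Real.norm_of_nonneg (integral_nonneg fun u => norm_nonneg _)]
      simp only [F, Function.uncurry_apply_pair, norm_mul (_ * _), integral_const_mul,
        norm_cpow_mul_exp_neg_mul hb, one_re]
      calc _ ≤ b ^ ν.re * rexp (-(1 * b)) *
            ((x ^ (-(ν.re + 1)) * N + N) / 2 * b ^ (-((ν.re + 1) / 2))) := by
            gcongr
            exact hPnorm hb
        _ = _ := by
            rw [show (ν.re - 1) / 2 = ν.re + -((ν.re + 1) / 2) by ring, Real.rpow_add hb]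
            ring
  have hswap := integral_integral_swap hFint
  have hleft : ∫ b in Ioi (0 : ℝ), ∫ u in Ioi (0 : ℝ), F b u = 0 := by
    refine integral_eq_zero_of_ae ?_
    have hne : ∀ᵐ b ∂(volume.restrict (Ioi (0 : ℝ))), b ≠ x :=
      ae_restrict_of_ae (by simp [ae_iff])
    filter_upwards [ae_restrict_mem measurableSet_Ioi, hne] with b hb hbx
    simp only [F, integral_const_mul, P]
    rw [integral_cpow_mul_besselSeries_mul_eq_zero hν hx hb hbx.symm (hPint hb), mul_zero]
    rfl
  have hright : ∫ u in Ioi (0 : ℝ), ∫ b in Ioi (0 : ℝ), F b u = cexp (-x) := by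
    have h := integral_cpow_mul_exp_mul_besselSeries hν (s := 1) (by simp) (-x)
    rw [div_one, div_one, one_cpow, one_mul] at h
    rw [← h]
    congr 1 with u
    have h2 := integral_cpow_mul_exp_mul_besselSeries hν (s := 1) (by simp) (-u)
    rw [div_one, div_one, one_cpow, one_mul] at h2
    rw [one_mul, ← h2, mul_right_comm, ← integral_const_mul]
    congr 1 with b
    simp only [F, P]
    rw [neg_mul_comm (u : ℂ), mul_comm (u : ℂ) (-b)]
    ring
  rw [hleft, hright] at hswap
  exact Complex.exp_ne_zero _ hswap.symm

theorem integral_cpow_mul_besselSeries_mul {ν : ℂ} (hν : -1 < ν.re) {x y : ℝ}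
    (hx : 0 < x) (hy : 0 < y) :
    ∫ u in Ioi (0 : ℝ), (u : ℂ) ^ ν * (besselSeries ν (-x * u) * besselSeries ν (-y * u)) = 0 := by
  by_cases hint : IntegrableOn (fun u : ℝ => (u : ℂ) ^ ν *
      (besselSeries ν (-x * u) * besselSeries ν (-y * u))) (Ioi 0)
  · refine integral_cpow_mul_besselSeries_mul_eq_zero hν hx hy ?_ hint
    rintro rfl
    exact not_integrableOn_cpow_mul_besselSeries_sq hν hx hint
  · exact integral_undef hint

theorem besselJ_eq {ν z : ℂ} (hz : z ≠ 0) :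
    besselJ ν z = (z / 2) ^ ν * besselSeries ν (-(z / 2) ^ 2) := by
  rw [besselJ, besselSeries, ← tsum_mul_left]
  refine tsum_congr fun m => ?_
  have h : (2 * (m : ℂ)) = ((2 * m : ℕ) : ℂ) := by push_cast; rfl
  rw [Complex.cpow_add _ _ (div_ne_zero hz two_ne_zero), h, Complex.cpow_natCast, pow_mul,
    neg_pow ((z / 2) ^ 2), besselCoeff, div_eq_mul_inv]
  ring

theorem besselI_eq {ν z : ℂ} (hz : 0 < z.re) :
    besselI ν z = (z / 2) ^ ν * besselSeries ν ((z / 2) ^ 2) := by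
  have hz0 : z ≠ 0 := by rintro rfl; simp at hz
  have hw : z / 2 ≠ 0 := div_ne_zero hz0 two_ne_zero
  have hwre : 0 < (z / 2).re := by
    have : (z / 2).re = z.re / 2 := by simp
    rw [this]
    positivity
  have harg := abs_lt.1 (Complex.abs_arg_lt_pi_div_two_iff.2 (.inl hwre))
  have hlog : Complex.log (I * (z / 2)) = Complex.log I + Complex.log (z / 2) := by
    refine Complex.log_mul I_ne_zero hw ⟨?_, ?_⟩ <;> rw [Complex.arg_I] <;> linarith [Real.pi_pos]
  have hcpow : (I * (z / 2)) ^ ν = I ^ ν * (z / 2) ^ ν := by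
    rw [Complex.cpow_def_of_ne_zero (mul_ne_zero I_ne_zero hw), hlog, add_mul, Complex.exp_add,
      Complex.cpow_def_of_ne_zero I_ne_zero, Complex.cpow_def_of_ne_zero hw]
  rw [besselI, besselJ_eq (mul_ne_zero I_ne_zero hz0), mul_div_assoc, hcpow, Complex.cpow_neg,
    mul_pow, I_sq, neg_one_mul, neg_neg, ← mul_assoc, ← mul_assoc,
    inv_mul_cancel₀ (by simp [Complex.cpow_eq_zero_iff]), one_mul]

theorem integral_exp_mul_besselJ_mul_besselJ {a b : ℝ} (ha : 0 < a) (hb : 0 < b) (s ν : ℂ) :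
    ∫ t in Ioi (0 : ℝ), cexp (-s * (t : ℂ) ^ 2) * besselJ ν (a * t) * besselJ ν (b * t) * t =
      ((a * b / 4 : ℝ) : ℂ) ^ ν / 2 * ∫ u in Ioi (0 : ℝ), (u : ℂ) ^ ν * cexp (-(s * u)) *
        (besselSeries ν (-((a / 2) ^ 2 : ℝ) * u) * besselSeries ν (-((b / 2) ^ 2 : ℝ) * u)) := by
  rw [← integral_comp_rpow_Ioi (fun u : ℝ => (u : ℂ) ^ ν * cexp (-(s * u)) *
    (besselSeries ν (-((a / 2) ^ 2 : ℝ) * u) * besselSeries ν (-((b / 2) ^ 2 : ℝ) * u)))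
    two_ne_zero, ← integral_const_mul]
  refine setIntegral_congr_fun measurableSet_Ioi fun t ht => ?_
  have ht : 0 < t := ht
  have hc : ∀ {c : ℝ}, 0 < c → besselJ ν (c * t) =
      ((c * t / 2 : ℝ) : ℂ) ^ ν * besselSeries ν (-((c / 2) ^ 2 : ℝ) * (t ^ 2 : ℝ)) := by
    intro c hc
    rw [besselJ_eq (by exact_mod_cast (mul_pos hc ht).ne')]
    push_cast
    ring_nf
  have hpow : ((a * t / 2 : ℝ) : ℂ) ^ ν * ((b * t / 2 : ℝ) : ℂ) ^ ν =
      ((a * b / 4 : ℝ) : ℂ) ^ ν * ((t ^ 2 : ℝ) : ℂ) ^ ν := by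
    rw [← mul_cpow_ofReal_nonneg (by positivity) (by positivity),
      ← mul_cpow_ofReal_nonneg (by positivity) (by positivity)]
    congr 1
    push_cast
    ring
  have h1 : |(2 : ℝ)| * t ^ ((2 : ℝ) - 1) = 2 * t := by norm_num
  simp only [hc ha, hc hb, h1, Real.rpow_two, Complex.real_smul]
  calc _ = cexp (-(s * (t ^ 2 : ℝ))) * (((a * t / 2 : ℝ) : ℂ) ^ ν * ((b * t / 2 : ℝ) : ℂ) ^ ν) *
        (besselSeries ν (-((a / 2) ^ 2 : ℝ) * (t ^ 2 : ℝ)) *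
          besselSeries ν (-((b / 2) ^ 2 : ℝ) * (t ^ 2 : ℝ))) * t := by
        rw [show -s * (t : ℂ) ^ 2 = -(s * (t ^ 2 : ℝ)) by push_cast; ring]
        ring
    _ = _ := by
        rw [hpow]
        push_cast
        ring

theorem sq_re_pos_of_abs_arg_lt {p : ℂ} (hp0 : p ≠ 0) (hp : |p.arg| < π / 4) :
    0 < (p ^ 2).re := by
  obtain ⟨h1, h2⟩ := abs_lt.1 hp
  have harg : (p ^ 2).arg = p.arg + p.arg := by
    rw [sq, Complex.arg_mul hp0 hp0]
    constructor <;> linarith [Real.pi_pos]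
  have h : |(p ^ 2).arg| < π / 2 := by
    rw [harg, abs_lt]
    constructor <;> linarith
  exact (Complex.abs_arg_lt_pi_div_two_iff.1 h).resolve_right (pow_ne_zero 2 hp0)

theorem weber_integral (a b : ℝ) (ha : 0 < a) (hb : 0 < b)
    (p : ℂ) (hp : |p.arg| < π/4) (ν : ℂ) (hν : -1 < ν.re) :
    ∫ t in Set.Ioi (0:ℝ),
        Complex.exp (-p^2 * (t:ℂ)^2) * besselJ ν (a * t) * besselJ ν (b * t) * (t:ℂ)
      = (1 / (2*p^2)) * Complex.exp (-((a:ℂ)^2 + (b:ℂ)^2) / (4*p^2)) *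
        besselI ν ((a:ℂ) * b / (2*p^2)) := by
  rw [integral_exp_mul_besselJ_mul_besselJ ha hb]
  rcases eq_or_ne p 0 with rfl | hp0
  · have h := integral_cpow_mul_besselSeries_mul hν (x := (a / 2) ^ 2) (y := (b / 2) ^ 2)
      (by positivity) (by positivity)
    simp [-neg_mul, -ofReal_pow, -ofReal_div, h]
  have hs := sq_re_pos_of_abs_arg_lt hp0 hp
  have hs0 : p ^ 2 ≠ 0 := pow_ne_zero 2 hp0
  have hinv : 0 < (1 / p ^ 2).re := by
    rw [one_div, Complex.inv_re]
    exact div_pos hs (Complex.normSq_pos.2 hs0)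
  have hz : (a : ℂ) * b / (2 * p ^ 2) = (a * b / 2 : ℝ) * (1 / p ^ 2) := by
    push_cast
    field_simp
  have hz2 : (a : ℂ) * b / (2 * p ^ 2) / 2 = (a * b / 4 : ℝ) * (1 / p ^ 2) := by
    push_cast
    field_simp
    norm_num
  have hzre : 0 < ((a : ℂ) * b / (2 * p ^ 2)).re := by
    rw [hz, Complex.re_ofReal_mul]
    positivity
  have hcpow : (((a * b / 4 : ℝ) : ℂ) * (1 / p ^ 2)) ^ ν =
      ((a * b / 4 : ℝ) : ℂ) ^ ν * (1 / p ^ 2) ^ ν := by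
    have hab : 0 < a * b / 4 := by positivity
    have hab0 : ((a * b / 4 : ℝ) : ℂ) ≠ 0 := by exact_mod_cast hab.ne'
    have hp2 := one_div_ne_zero hs0
    rw [Complex.cpow_def_of_ne_zero (mul_ne_zero hab0 hp2), Complex.log_ofReal_mul hab hp2,
      add_mul, Complex.exp_add, Complex.cpow_def_of_ne_zero hab0, Complex.cpow_def_of_ne_zero hp2,
      Complex.ofReal_log hab.le]
  rw [integral_cpow_mul_exp_mul_besselSeries_mul hν hs, besselI_eq hzre, hz2, hcpow,
    Complex.cpow_add _ _ (one_div_ne_zero hs0), Complex.cpow_one,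
    show (-((a / 2) ^ 2 : ℝ) : ℂ) * -((b / 2) ^ 2 : ℝ) / (p ^ 2) ^ 2 =
      ((a * b / 4 : ℝ) * (1 / p ^ 2)) ^ 2 by push_cast; field_simp; ring,
    show (-((a / 2) ^ 2 : ℝ) + -((b / 2) ^ 2 : ℝ) : ℂ) / p ^ 2 =
      -((a : ℂ) ^ 2 + (b : ℂ) ^ 2) / (4 * p ^ 2) by push_cast; field_simp; ring]
  ring
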